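/- Let $A$ be a finite dimensional algebra over a field with global dimension $n$. Then the injective dimension of $A$ as a right $A$-module equals $n$. -/

import Mathlib

universe u

open CategoryTheory

section Defs

variable (R : Type u) [Ring R]

/-- `pdLE R n M` : the module `M` has projective dimension at most `n`. -/
def pdLE : ℕ → ModuleCat.{u} R → Prop
  | 0, M => Module.Projective R M
  | (n+1), M => ∃ (P : ModuleCat.{u} R) (f : P →ₗ[R] M),
      Module.Projective R P ∧ Function.Surjective f ∧
      pdLE n (ModuleCat.of R (LinearMap.ker f))

/-- The projective dimension of a module, as an element of `ℕ∞` (`⊤` if no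
finite projective resolution exists). -/
noncomputable def projDim (M : ModuleCat.{u} R) : ℕ∞ :=
  sInf ((↑) '' {n : ℕ | pdLE R n M})

/-- `idLE R n M` : the module `M` has injective dimension at most `n`. -/
def idLE : ℕ → ModuleCat.{u} R → Prop
  | 0, M => Module.Injective R M
  | (n+1), M => ∃ (I : ModuleCat.{u} R) (f : M →ₗ[R] I),
      Module.Injective R I ∧ Function.Injective f ∧
      idLE n (ModuleCat.of R (I ⧸ LinearMap.range f))

/-- The injective dimension of a module, as an element of `ℕ∞`. -/
noncomputable def injDim (M : ModuleCat.{u} R) : ℕ∞ :=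
  sInf ((↑) '' {n : ℕ | idLE R n M})

/-- The global dimension (computed on finitely generated modules) is at most `n`. -/
def gldimLE (n : ℕ) : Prop :=
  ∀ M : ModuleCat.{u} R, Module.Finite R M → pdLE R n M

/-- The global dimension of `R`, computed on finitely generated modules. -/
noncomputable def globalDim : ℕ∞ :=
  sInf ((↑) '' {n : ℕ | gldimLE R n})

/-- The socle of a module: the sum of all its simple submodules. -/
def socle (M : Type u) [AddCommGroup M] [Module R M] : Submodule R M :=
  sSup {S : Submodule R M | IsSimpleModule R S}

/-- An algebra is an Auslander algebra if its global dimension is at most `2` and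
its dominant dimension is at least `2`, i.e. there is an exact sequence
`0 → R → I₀ → I₁` with `I₀`, `I₁` both projective and injective. -/
def IsAuslander : Prop :=
  gldimLE R 2 ∧
  ∃ (I₀ I₁ : ModuleCat.{u} R) (f : R →ₗ[R] I₀) (g : I₀ →ₗ[R] I₁),
    Module.Injective R I₀ ∧ Module.Projective R I₀ ∧
    Module.Injective R I₁ ∧ Module.Projective R I₁ ∧
    Function.Injective f ∧ LinearMap.ker g = LinearMap.range f

/-- `f : M →ₗ[R] I` realizes `I` as an injective envelope of `M`: `I` is injective
and `f` is an essential embedding. -/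
def IsInjectiveEnvelope {M I : Type u} [AddCommGroup M] [Module R M]
    [AddCommGroup I] [Module R I] (f : M →ₗ[R] I) : Prop :=
  Module.Injective R I ∧ Function.Injective f ∧
    ∀ N : Submodule R I, N ≠ ⊥ → N ⊓ LinearMap.range f ≠ ⊥

end Defs

open CategoryTheory Abelian

section Aux

variable {R : Type u} [Ring R]

theorem ses_ker {P M : Type u} [AddCommGroup P] [Module R P] [AddCommGroup M] [Module R M]
    (f : P →ₗ[R] M) (hf : Function.Surjective f) :
    (f.shortComplexKer).ShortExact :=
  LinearMap.shortExact_shortComplexKer hf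

theorem pdLE_iff (n : ℕ) (M : ModuleCat.{u} R) :
    pdLE R n M ↔ HasProjectiveDimensionLT M (n + 1) := by
  induction n generalizing M with
  | zero =>
    rw [pdLE, zero_add, ← projective_iff_hasProjectiveDimensionLT_one]
    exact IsProjective.iff_projective M
  | succ n ih =>
    constructor
    · rintro ⟨P, f, hP, hf, h⟩
      have hS := ses_ker f hf
      have hP' : Projective P := (IsProjective.iff_projective P).1 hP
      exact (hS.hasProjectiveDimensionLT_X₃_iff n hP').2 ((ih _).1 h)
    · intro h
      let f : (M →₀ R) →ₗ[R] M := Finsupp.linearCombination R (id : M → M)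
      have hf : Function.Surjective f := Finsupp.linearCombination_id_surjective R M
      have hS := ses_ker f hf
      have hP' : Projective (ModuleCat.of R (M →₀ R)) :=
        (IsProjective.iff_projective _).1 inferInstance
      exact ⟨ModuleCat.of R (M →₀ R), f, (inferInstance : Module.Projective R (M →₀ R)), hf,
        (ih _).2 ((hS.hasProjectiveDimensionLT_X₃_iff n hP').1 h)⟩

theorem ses_coker {M I : ModuleCat.{u} R} (f : M →ₗ[R] I) (hf : Function.Injective f) :
    (ModuleCat.shortComplexOfCompEqZero f (LinearMap.range f).mkQ
      f.exact_map_mkQ_range.linearMap_comp_eq_zero).ShortExact :=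
  ModuleCat.shortComplex_shortExact _ f.exact_map_mkQ_range hf (Submodule.mkQ_surjective _)

theorem idLE_iff (n : ℕ) (M : ModuleCat.{u} R) :
    idLE R n M ↔ HasInjectiveDimensionLT M (n + 1) := by
  induction n generalizing M with
  | zero =>
    rw [idLE, zero_add, ← injective_iff_hasInjectiveDimensionLT_one]
    exact Module.injective_iff_injective_object R M
  | succ n ih =>
    constructor
    · rintro ⟨I, f, hI, hf, h⟩
      have hS := ses_coker f hf
      have hI' : Injective I := (Module.injective_iff_injective_object R I).1 hI
      exact (hS.hasInjectiveDimensionLT_X₃_iff n hI').1 ((ih _).1 h)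
    · intro h
      obtain ⟨I, hI, f, hf⟩ := EnoughInjectives.presentation M
      have hf' : Function.Injective f.hom := (ModuleCat.mono_iff_injective f).mp hf
      have hS := ses_coker f.hom hf'
      exact ⟨I, f.hom, (Module.injective_iff_injective_object R I).2 hI, hf',
        (ih _).2 ((hS.hasInjectiveDimensionLT_X₃_iff n hI).2 h)⟩

/-- A lifting criterion: `Ext¹(M, ker f) = 0` gives a section of `f`. -/
theorem projective_of_ext_one [IsNoetherianRing R] (M : ModuleCat.{u} R) [Module.Finite R M]
    (h : ∀ N : ModuleCat.{u} R, Module.Finite R N → ∀ e : Ext M N 1, e = 0) :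
    Projective M := by
  obtain ⟨r, f, hf⟩ := Module.Finite.exists_fin' R M
  have hS := ses_ker f hf
  obtain ⟨φ, hφ⟩ := Ext.covariant_sequence_exact₃ M hS (Ext.mk₀ (𝟙 M)) (zero_add 1)
    (h (ModuleCat.of R (LinearMap.ker f))
      (inferInstance : Module.Finite R (LinearMap.ker f)) _)
  obtain ⟨φ, rfl⟩ := Ext.homEquiv₀.symm.surjective φ
  have h1 : φ ≫ ModuleCat.ofHom f = 𝟙 M := Ext.homEquiv₀.symm.injective (by simpa using hφ)
  have hP' : Projective (ModuleCat.of R (Fin r → R)) :=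
    (IsProjective.iff_projective _).1 inferInstance
  exact Retract.projective ⟨φ, ModuleCat.ofHom f, h1⟩

theorem pd_of_ext [IsNoetherianRing R] (j : ℕ) (M : ModuleCat.{u} R) [Module.Finite R M]
    (h : ∀ N : ModuleCat.{u} R, Module.Finite R N → ∀ e : Ext M N (j + 1), e = 0) :
    HasProjectiveDimensionLT M (j + 1) := by
  induction j generalizing M with
  | zero =>
    have := projective_of_ext_one M h
    rw [zero_add]
    infer_instance
  | succ j ih =>
    obtain ⟨r, f, hf⟩ := Module.Finite.exists_fin' R M
    have hS := ses_ker f hf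
    have hP' : Projective (ModuleCat.of R (Fin r → R)) :=
      (IsProjective.iff_projective _).1 inferInstance
    refine (hS.hasProjectiveDimensionLT_X₃_iff j hP').2 ?_
    refine @ih (ModuleCat.of R (LinearMap.ker f))
      (inferInstance : Module.Finite R (LinearMap.ker f)) ?_
    intro N hN e
    obtain ⟨e', rfl⟩ := Ext.contravariant_sequence_exact₁ hS N e (add_comm 1 (j + 1))
      (h N hN _)
    rw [Ext.eq_zero_of_projective e', Ext.comp_zero]

theorem id_free (m : ℕ) (h : HasInjectiveDimensionLT (ModuleCat.of R R) m) (r : ℕ) :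
    HasInjectiveDimensionLT (ModuleCat.of R (Fin r → R)) m := by
  induction r with
  | zero =>
    have := (ModuleCat.isZero_of_subsingleton
      (ModuleCat.of R (Fin 0 → R))).hasInjectiveDimensionLT_zero
    exact hasInjectiveDimensionLT_of_ge _ 0 m (Nat.zero_le _)
  | succ r ih =>
    have hS := ModuleCat.shortComplex_shortExact
      (ModuleCat.shortComplexOfCompEqZero (LinearMap.inl R R (Fin r → R))
        (LinearMap.snd R R (Fin r → R)) (by ext <;> simp))
      Function.Exact.inl_snd LinearMap.inl_injective LinearMap.snd_surjective
    have h2 : HasInjectiveDimensionLT (ModuleCat.of R (R × (Fin r → R))) m :=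
      hS.hasInjectiveDimensionLT_X₂ m h ih
    exact hasInjectiveDimensionLT_of_iso
      (Fin.consLinearEquiv R (fun _ : Fin (r + 1) => R)).toModuleIso m

theorem ext_descent [IsNoetherianRing R] (m : ℕ)
    (h : HasInjectiveDimensionLT (ModuleCat.of R R) (m + 1)) (d : ℕ)
    (hd : ∀ M N : ModuleCat.{u} R, Module.Finite R M → Module.Finite R N →
      ∀ e : Ext M N (m + d + 1), e = 0) :
    ∀ M N : ModuleCat.{u} R, Module.Finite R M → Module.Finite R N →
      ∀ e : Ext M N (m + 1), e = 0 := by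
  induction d with
  | zero => exact hd
  | succ d ih =>
    refine ih fun M N hM hN e => ?_
    obtain ⟨r, f, hf⟩ := Module.Finite.exists_fin' R N
    have hS := ses_ker f hf
    obtain ⟨e', rfl⟩ := Ext.covariant_sequence_exact₃ M hS e rfl
      (hd M (ModuleCat.of R (LinearMap.ker f)) hM
        (inferInstance : Module.Finite R (LinearMap.ker f)) _)
    have := id_free (m + 1) h r
    have h0 : e' = 0 :=
      Ext.eq_zero_of_hasInjectiveDimensionLT (X := ModuleCat.of R (Fin r → R)) e' (m + 1)
        (by omega)
    rw [h0, Ext.zero_comp]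

/-- Baer's criterion in terms of `Ext¹`. -/
theorem injective_of_ext_one (N : ModuleCat.{u} R)
    (h : ∀ M : ModuleCat.{u} R, Module.Finite R M → ∀ e : Ext M N 1, e = 0) :
    Injective N := by
  rw [← Module.injective_iff_injective_object, ← Module.Baer.iff_injective]
  intro I g
  have hS := ModuleCat.shortComplex_shortExact
      (ModuleCat.shortComplexOfCompEqZero I.subtype I.mkQ (by ext; simp))
      (LinearMap.exact_subtype_mkQ I) Subtype.val_injective (Submodule.mkQ_surjective I)
  obtain ⟨φ, hφ⟩ := Ext.contravariant_sequence_exact₁ hS N (Ext.mk₀ (ModuleCat.ofHom g))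
    (add_zero 1) (h (ModuleCat.of R (R ⧸ I)) (inferInstance : Module.Finite R (R ⧸ I)) _)
  obtain ⟨φ, rfl⟩ := Ext.homEquiv₀.symm.surjective φ
  have h1 : ModuleCat.ofHom I.subtype ≫ φ = ModuleCat.ofHom g :=
    Ext.homEquiv₀.symm.injective (by simpa using hφ)
  refine ⟨φ.hom, fun x hx => ?_⟩
  exact congrArg (fun t => t.hom ⟨x, hx⟩) h1

theorem id_of_ext (j : ℕ) (N : ModuleCat.{u} R)
    (h : ∀ M : ModuleCat.{u} R, Module.Finite R M → ∀ e : Ext M N (j + 1), e = 0) :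
    HasInjectiveDimensionLT N (j + 1) := by
  induction j generalizing N with
  | zero =>
    have := injective_of_ext_one N h
    rw [zero_add]
    infer_instance
  | succ j ih =>
    obtain ⟨I, hI, f, hf⟩ := EnoughInjectives.presentation N
    have hf' : Function.Injective f.hom := (ModuleCat.mono_iff_injective f).mp hf
    have hS := ses_coker f.hom hf'
    refine (hS.hasInjectiveDimensionLT_X₃_iff j hI).1 ?_
    refine ih _ ?_
    intro M hM e
    obtain ⟨e', rfl⟩ := Ext.covariant_sequence_exact₃ M hS e rfl (h M hM _)
    have h0 : e' = 0 := Ext.eq_zero_of_injective (I := I) e'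
    rw [h0, Ext.zero_comp]

theorem coe_sInf_mem {s : Set ℕ} {n : ℕ} (h : sInf (((↑) : ℕ → ℕ∞) '' s) = n) : n ∈ s := by
  rcases s.eq_empty_or_nonempty with rfl | hs
  · simp at h
  · have := csInf_mem (hs.image ((↑) : ℕ → ℕ∞))
    rw [h] at this
    obtain ⟨a, ha, hn⟩ := this
    rwa [← Nat.cast_injective hn]

end Aux

/-- If a finite dimensional algebra `A` has global dimension `n`, then the injective
dimension of the regular module `A` equals `n`. -/
theorem stmt_1 (k A : Type u) [Field k] [Ring A] [Algebra k A] [FiniteDimensional k A] (n : ℕ)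
    (h : globalDim A = n) :
    injDim A (ModuleCat.of A A) = n := by
  have : IsNoetherianRing A := IsNoetherianRing.of_finite k A
  have hn : gldimLE A n := coe_sInf_mem h
  have hpd : ∀ M : ModuleCat.{u} A, Module.Finite A M → HasProjectiveDimensionLT M (n + 1) :=
    fun M hM => (pdLE_iff n M).1 (hn M hM)
  have hid : HasInjectiveDimensionLT (ModuleCat.of A A) (n + 1) := by
    refine id_of_ext n _ fun M hM e => ?_
    have := hpd M hM
    exact e.eq_zero_of_hasProjectiveDimensionLT (n + 1) le_rfl
  apply le_antisymm
  · exact sInf_le ⟨n, (idLE_iff n _).2 hid, rfl⟩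
  · refine le_sInf ?_
    rintro _ ⟨m, hm, rfl⟩
    have hm' := (idLE_iff m _).1 hm
    rw [← h]
    refine sInf_le ⟨m, ?_, rfl⟩
    intro M hM
    rw [pdLE_iff]
    refine pd_of_ext m M fun N hN e => ?_
    refine ext_descent m hm' n (fun M' N' hM' _ e' => ?_) M N hM hN e
    have := hpd M' hM'
    exact e'.eq_zero_of_hasProjectiveDimensionLT (n + 1) (by omega)
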